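/- Let G=(V,E) be a finite simple graph with ℛ₂-components H₁, H₂, …, H_q, and let u,v ∈ V be a non-adjacent vertex pair with u,v ∈ V(H₁). Then the ℛ₂-components of G+uv are H₁+uv, H₂, …, H_q. In particular, the vertex sets of the ℛ₂-components of G and of G+uv are the same. -/

import Mathlib

open scoped BigOperators

noncomputable section

namespace Rigidity

variable {V : Type*}

/-- Euclidean distance between two points of `ℝ^d` (given as coordinate functions). -/
def eDist {d : ℕ} (x y : Fin d → ℝ) : ℝ := Real.sqrt (∑ i, (x i - y i) ^ 2)

/-- Two frameworks `(G,p)` and `(G,q)` are equivalent if corresponding edge lengths agree. -/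
def Equivalent {d : ℕ} (G : SimpleGraph V) (p q : V → Fin d → ℝ) : Prop :=
  ∀ u v : V, G.Adj u v → eDist (p u) (p v) = eDist (q u) (q v)

/-- Two placements are congruent if all pairwise distances agree. -/
def Congruent {d : ℕ} (p q : V → Fin d → ℝ) : Prop :=
  ∀ u v : V, eDist (p u) (p v) = eDist (q u) (q v)

/-- A placement is generic if the multiset of its coordinates is algebraically
independent over `ℚ`. -/
def Generic {d : ℕ} (p : V → Fin d → ℝ) : Prop :=
  AlgebraicIndependent ℚ (fun vi : V × Fin d => p vi.1 vi.2)

/-- `{u,v}` is globally linked in the framework `(G,p)`. -/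
def GloballyLinkedIn {d : ℕ} (G : SimpleGraph V) (p : V → Fin d → ℝ) (u v : V) : Prop :=
  ∀ q : V → Fin d → ℝ, Equivalent G p q → eDist (q u) (q v) = eDist (p u) (p v)

/-- `{u,v}` is globally `d`-linked in `G`. -/
def GloballyLinked (d : ℕ) (G : SimpleGraph V) (u v : V) : Prop :=
  ∀ p : V → Fin d → ℝ, Generic p → GloballyLinkedIn G p u v

/-- The framework `(G,p)` is rigid. -/
def RigidFramework {d : ℕ} (G : SimpleGraph V) (p : V → Fin d → ℝ) : Prop :=
  ∃ ε > (0:ℝ), ∀ q : V → Fin d → ℝ, Equivalent G p q →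
    (∀ v, eDist (p v) (q v) < ε) → Congruent p q

/-- `G` is `d`-rigid: every generic framework of `G` in `ℝ^d` is rigid. -/
def IsRigidGraph (d : ℕ) (G : SimpleGraph V) : Prop :=
  ∀ p : V → Fin d → ℝ, Generic p → RigidFramework G p

/-- The framework `(G,p)` is globally rigid. -/
def GloballyRigidFramework {d : ℕ} (G : SimpleGraph V) (p : V → Fin d → ℝ) : Prop :=
  ∀ q : V → Fin d → ℝ, Equivalent G p q → Congruent p q

/-- The row of the rigidity matrix corresponding to the (ordered) edge `(u,v)`. -/
def edgeVec [DecidableEq V] {d : ℕ} (p : V → Fin d → ℝ) (u v : V) : V × Fin d → ℝ :=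
  fun wi => if wi.1 = u then p u wi.2 - p v wi.2
            else if wi.1 = v then p v wi.2 - p u wi.2 else 0

/-- The rank of the set of rows of the rigidity matrix of `(·,p)` indexed by `F`. -/
def rankAt [DecidableEq V] (d : ℕ) (p : V → Fin d → ℝ) (F : Set (Sym2 V)) : ℕ :=
  Module.finrank ℝ (Submodule.span ℝ
    {x : V × Fin d → ℝ | ∃ u v : V, s(u, v) ∈ F ∧ x = edgeVec p u v})

/-- `r_d(F)`: the rank of the set of rows indexed by `F` of the rigidity matrix of a
generic framework, equivalently the maximum of this rank over all placements. -/
def rd [DecidableEq V] (d : ℕ) (F : Set (Sym2 V)) : ℕ :=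
  sSup {n : ℕ | ∃ p : V → Fin d → ℝ, n = rankAt d p F}

/-- An edge set is `ℛ_d`-independent if its rank equals its cardinality. -/
def RdIndep [DecidableEq V] (d : ℕ) (F : Set (Sym2 V)) : Prop := rd d F = F.ncard

/-- An `ℛ_d`-circuit: not independent, but every proper subset is independent. -/
def RdCircuit [DecidableEq V] (d : ℕ) (C : Set (Sym2 V)) : Prop :=
  ¬ RdIndep d C ∧ ∀ C' : Set (Sym2 V), C' ⊂ C → RdIndep d C'

/-- An `ℛ_d`-circuit of the graph `G`. -/
def RdCircuitOf [DecidableEq V] (d : ℕ) (G : SimpleGraph V) (C : Set (Sym2 V)) : Prop :=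
  C ⊆ G.edgeSet ∧ RdCircuit d C

/-- `F` is (the edge set of) an `ℛ_d`-component of `G`: an equivalence class of the
relation "`e = f` or some `ℛ_d`-circuit of `G` contains both `e` and `f`". -/
def IsRdComponent [DecidableEq V] (d : ℕ) (G : SimpleGraph V) (F : Set (Sym2 V)) : Prop :=
  ∃ e ∈ G.edgeSet, F = {f | f ∈ G.edgeSet ∧
    (e = f ∨ ∃ C, RdCircuitOf d G C ∧ e ∈ C ∧ f ∈ C)}

/-- The set of vertices covered by an edge set. -/
def vertexSpan (F : Set (Sym2 V)) : Set V := {v | ∃ e ∈ F, v ∈ e}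

/-- A nonempty edge set is `ℛ_d`-connected if any two of its edges lie on a common
`ℛ_d`-circuit contained in it (or are equal). -/
def RdConnectedSet [DecidableEq V] (d : ℕ) (F : Set (Sym2 V)) : Prop :=
  F.Nonempty ∧ ∀ e ∈ F, ∀ f ∈ F, e = f ∨ ∃ C, C ⊆ F ∧ RdCircuit d C ∧ e ∈ C ∧ f ∈ C

/-- A graph (with at least one edge) is `ℛ_d`-connected. -/
def RdConnected [DecidableEq V] (d : ℕ) (H : SimpleGraph V) : Prop :=
  RdConnectedSet d H.edgeSet

/-- `e` is an `ℛ_d`-bridge of `G`: `r_d(E ∖ {e}) = r_d(E) − 1`. -/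
def IsRdBridge [DecidableEq V] (d : ℕ) (G : SimpleGraph V) (e : Sym2 V) : Prop :=
  e ∈ G.edgeSet ∧ rd d (G.edgeSet \ {e}) + 1 = rd d G.edgeSet

/-- `G + uv`. -/
def addEdge (G : SimpleGraph V) (u v : V) : SimpleGraph V :=
  G ⊔ SimpleGraph.fromEdgeSet {s(u, v)}

/-- `{u,v}` is `d`-linked in `G` if `r_d(G+uv) = r_d(G)`. -/
def IsLinked [DecidableEq V] (d : ℕ) (G : SimpleGraph V) (u v : V) : Prop :=
  rd d (addEdge G u v).edgeSet = rd d G.edgeSet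

/-- There exist `k` pairwise internally vertex-disjoint `u`–`v` paths in `H`
(i.e. `κ_H(u,v) ≥ k`). -/
def InternallyDisjointPaths (H : SimpleGraph V) (u v : V) (k : ℕ) : Prop :=
  ∃ P : Fin k → H.Walk u v, (∀ i, (P i).IsPath) ∧
    ∀ i j, i ≠ j → ∀ w, w ∈ (P i).support → w ∈ (P j).support → w = u ∨ w = v

/-- An unordered pair forming a 2-separator: two distinct vertices whose deletion
disconnects the graph. -/
def TwoSepPair (H : SimpleGraph V) (e : Sym2 V) : Prop :=
  ¬ e.IsDiag ∧ ¬ (H.induce {v | v ∉ e}).Connected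

/-- The augmented graph `Ĥ`: add an edge for every 2-separator. -/
def aug (H : SimpleGraph V) : SimpleGraph V :=
  H ⊔ SimpleGraph.fromEdgeSet {e | TwoSepPair H e}

/-- A subgraph is 3-connected: at least 4 vertices, and deleting fewer than 3
vertices leaves it connected. -/
def IsThreeConnectedSubgraph {G : SimpleGraph V} (J : G.Subgraph) : Prop :=
  4 ≤ J.verts.ncard ∧ ∀ S : Set V, S.ncard < 3 → (J.deleteVerts S).coe.Connected

/-- A 3-block of `H`: a maximal 3-connected subgraph of the augmented graph `Ĥ`. -/
def IsThreeBlock (H : SimpleGraph V) (J : (aug H).Subgraph) : Prop :=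
  IsThreeConnectedSubgraph J ∧
    ∀ J' : (aug H).Subgraph, IsThreeConnectedSubgraph J' → J ≤ J' → J = J'

/-- `h_H(e)`: the number of 3-blocks of `H` containing both vertices of `e`. -/
def numBlocksOn (H : SimpleGraph V) (e : Sym2 V) : ℕ :=
  {J : (aug H).Subgraph | IsThreeBlock H J ∧ ∀ v ∈ e, v ∈ J.verts}.ncard

open Classical in
/-- `k(H) = Σ (h_H(ab) − 1)` over all 2-separators `{a,b}` of `H`. -/
def kGraph [Fintype V] [DecidableEq V] (H : SimpleGraph V) : ℕ :=
  ∑ e : Sym2 V, if TwoSepPair H e then numBlocksOn H e - 1 else 0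

/-- The graph of an `ℛ₂`-component, on its own vertex set. -/
def componentGraph [DecidableEq V] (F : Set (Sym2 V)) :
    SimpleGraph (vertexSpan F) :=
  (SimpleGraph.fromEdgeSet F).induce (vertexSpan F)

/-- `X` is the vertex set of an `ℛ_d`-block of `G`: a 3-block of a non-trivial
`ℛ_d`-component of `G`. -/
def IsRdBlockVerts [DecidableEq V] (d : ℕ) (G : SimpleGraph V) (X : Set V) : Prop :=
  ∃ F : Set (Sym2 V), IsRdComponent d G F ∧ 2 ≤ F.ncard ∧
    ∃ J : (aug (componentGraph F)).Subgraph,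
      IsThreeBlock (componentGraph F) J ∧ X = Subtype.val '' J.verts

/-- The globally linked closure of `G` in `ℝ^d`. -/
def glc (d : ℕ) (G : SimpleGraph V) : SimpleGraph V :=
  G ⊔ SimpleGraph.fromEdgeSet {e | ∃ u v : V, e = s(u, v) ∧ GloballyLinked d G u v}

/-- A globally `d`-linked cluster: the vertex set of a maximal complete subgraph of
`glc_d(G)`. -/
def IsCluster (d : ℕ) (G : SimpleGraph V) (X : Set V) : Prop :=
  (∀ a ∈ X, ∀ b ∈ X, a ≠ b → (glc d G).Adj a b) ∧
    ∀ Y : Set V, X ⊆ Y → (∀ a ∈ Y, ∀ b ∈ Y, a ≠ b → (glc d G).Adj a b) → Y = X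

/-- Equilibrium stress of a framework, encoded as a symmetric function vanishing on
non-edges. -/
def IsEqStress [Fintype V] {d : ℕ} (G : SimpleGraph V) (p : V → Fin d → ℝ)
    (ω : V → V → ℝ) : Prop :=
  (∀ u v, ω u v = ω v u) ∧ (∀ u v, ¬ G.Adj u v → ω u v = 0) ∧
    ∀ u, ∑ v, ω u v • (p u - p v) = 0

/-- `{u,v}` is `d`-stress-linked in `G`. -/
def StressLinked [Fintype V] (d : ℕ) (G : SimpleGraph V) (u v : V) : Prop :=
  ∀ p : V → Fin d → ℝ, Generic p → ∀ q : V → Fin d → ℝ,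
    (∀ ω, IsEqStress G p ω → IsEqStress G q ω) →
    ∀ ω, IsEqStress (addEdge G u v) p ω → IsEqStress (addEdge G u v) q ω

/-- Equivalence of complex frameworks. -/
def CEquivalent {d : ℕ} (G : SimpleGraph V) (p q : V → Fin d → ℂ) : Prop :=
  ∀ u v : V, G.Adj u v →
    ∑ i, (p u i - p v i) ^ 2 = ∑ i, (q u i - q v i) ^ 2

/-- Generic complex placement. -/
def CGeneric {d : ℕ} (p : V → Fin d → ℂ) : Prop :=
  AlgebraicIndependent ℚ (fun vi : V × Fin d => p vi.1 vi.2)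

/-- `{u,v}` is globally linked in `G` in `ℂ^d`. -/
def CGloballyLinked (d : ℕ) (G : SimpleGraph V) (u v : V) : Prop :=
  ∀ p : V → Fin d → ℂ, CGeneric p → ∀ q : V → Fin d → ℂ, CEquivalent G p q →
    ∑ i, (q u i - q v i) ^ 2 = ∑ i, (p u i - p v i) ^ 2

/-- A flexing of the framework `(G,q)`. -/
def IsFlexing {d : ℕ} (G : SimpleGraph V) (q : V → Fin d → ℝ)
    (φ : Set.Icc (0:ℝ) 1 → V → Fin d → ℝ) : Prop :=
  Continuous φ ∧ φ ⟨0, Set.left_mem_Icc.mpr zero_le_one⟩ = q ∧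
    (∀ t, Equivalent G q (φ t)) ∧
    ∀ t : Set.Icc (0:ℝ) 1, 0 < (t : ℝ) → ¬ Congruent q (φ t)

/-- A finite loopless multigraph on vertex type `V` with edge type `E`. -/
structure Multigraph (V : Type*) (E : Type*) where
  ends : E → Sym2 V
  loopless : ∀ e, ¬ (ends e).IsDiag

/-- The data `(B, bar)` exhibits `G` as a body-bar graph induced by `H`. -/
def IsBodyBar {V E W : Type*} (H : Multigraph V E) (G : SimpleGraph W)
    (B : V → Set W) (bar : E → W × W) : Prop :=
  (∀ w : W, ∃! v : V, w ∈ B v) ∧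
  (∀ v : V, (B v).ncard = {e : E | v ∈ H.ends e}.ncard) ∧
  (∀ e : E, ∃ w z : V, H.ends e = s(w, z) ∧ (bar e).1 ∈ B w ∧ (bar e).2 ∈ B z) ∧
  (∀ e : E, (bar e).1 ≠ (bar e).2) ∧
  (∀ e e' : E, e ≠ e' →
    ({(bar e).1, (bar e).2} ∩ {(bar e').1, (bar e').2} : Set W) = ∅) ∧
  (∀ a b : W, G.Adj a b ↔ a ≠ b ∧
    ((∃ v : V, a ∈ B v ∧ b ∈ B v) ∨ ∃ e : E, s(a, b) = s((bar e).1, (bar e).2)))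

/-- `P` is a partition of the set `X`. -/
def IsPartitionOf {V : Type*} (X : Set V) (P : Set (Set V)) : Prop :=
  (∀ p ∈ P, p.Nonempty ∧ p ⊆ X) ∧ ∀ v ∈ X, ∃! p, p ∈ P ∧ v ∈ p

/-- The subgraph `(X,F)` of the multigraph `H` is `k`-tree-connected. -/
def SubTreeConnected {V E : Type*} (k : ℕ) (H : Multigraph V E)
    (X : Set V) (F : Set E) : Prop :=
  X.Nonempty ∧ (∀ e ∈ F, ∀ v ∈ H.ends e, v ∈ X) ∧
    ∀ P : Set (Set V), IsPartitionOf X P →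
      k * (P.ncard - 1) ≤ {e | e ∈ F ∧ ¬ ∃ p ∈ P, ∀ v ∈ H.ends e, v ∈ p}.ncard

/-- `(X,F)` is a `k`-superbrick of `H`: a maximal `k`-tree-connected subgraph. -/
def IsSuperbrick {V E : Type*} (k : ℕ) (H : Multigraph V E)
    (X : Set V) (F : Set E) : Prop :=
  SubTreeConnected k H X F ∧
    ∀ X' F', SubTreeConnected k H X' F' → X ⊆ X' → F ⊆ F' → X = X' ∧ F = F'

section MatroidConnectivity

variable {α : Type*}

/-- `e` and `f` are equal or lie on a common circuit of `M` contained in `E`. -/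
def CircuitRel (M : Matroid α) (E : Set α) (e f : α) : Prop :=
  e = f ∨ ∃ C, C ⊆ E ∧ M.IsCircuit C ∧ e ∈ C ∧ f ∈ C

theorem CircuitRel.symm {M : Matroid α} {E : Set α} {e f : α} (h : CircuitRel M E e f) :
    CircuitRel M E f e := by
  rcases h with rfl | ⟨C, hCE, hC, he, hf⟩
  · exact Or.inl rfl
  · exact Or.inr ⟨C, hCE, hC, hf, he⟩

theorem CircuitRel.mono {M : Matroid α} {E E' : Set α} (hE : E ⊆ E') {e f : α}
    (h : CircuitRel M E e f) : CircuitRel M E' e f := by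
  rcases h with rfl | ⟨C, hCE, hC, he, hf⟩
  · exact Or.inl rfl
  · exact Or.inr ⟨C, hCE.trans hE, hC, he, hf⟩

theorem exists_isCircuit_of_inter_nonempty [Finite α] {M : Matroid α} {C₁ C₂ : Set α} {e f : α}
    (h₁ : M.IsCircuit C₁) (h₂ : M.IsCircuit C₂) (he : e ∈ C₁) (hf : f ∈ C₂)
    (hne : (C₁ ∩ C₂).Nonempty) : ∃ C ⊆ C₁ ∪ C₂, M.IsCircuit C ∧ e ∈ C ∧ f ∈ C := by
  induction hn : (C₁ ∪ C₂).ncard using Nat.strong_induction_on generalizing C₁ C₂ with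
  | _ n ih =>
  subst hn
  by_contra hcon
  have heC₂ : e ∉ C₂ := fun h => hcon ⟨C₂, Set.subset_union_right, h₂, h, hf⟩
  have hfC₁ : f ∉ C₁ := fun h => hcon ⟨C₁, Set.subset_union_left, h₁, he, h⟩
  obtain ⟨g, hg₁, hg₂⟩ := hne
  obtain ⟨C₃, hC₃, h₃, hf₃⟩ := h₂.strong_elimination h₁ hg₂ hg₁ hf hfC₁
  have hC₃' : C₃ ⊆ C₁ ∪ C₂ := fun x hx => (hC₃ hx).1.symm
  have hx : ∃ x ∈ C₃, x ∉ C₂ := by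
    by_contra! h
    have := h₃.eq_of_subset_isCircuit h₂ h
    exact (hC₃ (this ▸ hg₂)).2 rfl
  obtain ⟨x, hx₃, hx₂⟩ := hx
  have hx₁ : x ∈ C₁ := (hC₃' hx₃).resolve_right hx₂
  have hU' : C₁ ∪ C₃ ⊆ C₁ ∪ C₂ := Set.union_subset Set.subset_union_left hC₃'
  by_cases hlt : (C₁ ∪ C₃).ncard < (C₁ ∪ C₂).ncard
  · obtain ⟨C, hC, hcirc, heC, hfC⟩ := ih _ hlt h₁ h₃ he hf₃ ⟨x, hx₁, hx₃⟩ rfl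
    exact hcon ⟨C, hC.trans hU', hcirc, heC, hfC⟩
  have he₃ : e ∉ C₃ := fun h => hcon ⟨C₃, hC₃', h₃, h, hf₃⟩
  obtain ⟨C₄, hC₄, h₄, he₄⟩ := h₁.strong_elimination h₃ hx₁ hx₃ he he₃
  have hC₄' : C₄ ⊆ C₁ ∪ C₂ := fun y hy => hU' (hC₄ hy).1
  have hy : ∃ y ∈ C₄, y ∉ C₁ := by
    by_contra! h
    have := h₄.eq_of_subset_isCircuit h₁ h
    exact (hC₄ (this ▸ hx₁)).2 rfl
  obtain ⟨y, hy₄, hy₁⟩ := hy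
  have hy₂ : y ∈ C₂ := (hC₄' hy₄).resolve_left hy₁
  have hU₄ : C₄ ∪ C₂ ⊆ C₁ ∪ C₂ := Set.union_subset hC₄' Set.subset_union_right
  have hlt' : (C₄ ∪ C₂).ncard < (C₁ ∪ C₂).ncard :=
    Set.ncard_lt_ncard ⟨hU₄, fun h =>
      (h (Or.inl hx₁)).elim (fun h => (hC₄ h).2 rfl) hx₂⟩ (Set.toFinite _)
  obtain ⟨C, hC, hcirc, heC, hfC⟩ := ih _ hlt' h₄ h₂ he₄ hf ⟨y, hy₄, hy₂⟩ rfl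
  exact hcon ⟨C, hC.trans hU₄, hcirc, heC, hfC⟩

theorem CircuitRel.trans [Finite α] {M : Matroid α} {E : Set α} {e f g : α}
    (h : CircuitRel M E e f) (h' : CircuitRel M E f g) : CircuitRel M E e g := by
  rcases h with rfl | ⟨C, hCE, hC, he, hf⟩
  · exact h'
  rcases h' with rfl | ⟨D, hDE, hD, hf', hg⟩
  · exact Or.inr ⟨C, hCE, hC, he, hf⟩
  obtain ⟨B, hB, h⟩ := exists_isCircuit_of_inter_nonempty hC hD he hg ⟨f, hf, hf'⟩
  exact Or.inr ⟨B, hB.trans (Set.union_subset hCE hDE), h⟩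

/-- The class of `e` under `CircuitRel M E`. -/
def circuitClass (M : Matroid α) (E : Set α) (e : α) : Set α := {f | f ∈ E ∧ CircuitRel M E e f}

theorem circuitClass_eq [Finite α] {M : Matroid α} {E : Set α} {e f : α}
    (h : CircuitRel M E e f) : circuitClass M E e = circuitClass M E f := by
  ext g
  exact ⟨fun hg => ⟨hg.1, h.symm.trans hg.2⟩, fun hg => ⟨hg.1, h.trans hg.2⟩⟩

theorem not_mem_of_isCircuit_insert [Finite α] {M : Matroid α} {E C : Set α} {e₁ e f : α}
    (hfE : f ∉ E) (hf : f ∈ M.closure (circuitClass M E e₁)) (hC : M.IsCircuit C)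
    (hCE : C ⊆ insert f E) (heC : e ∈ C) (heE : e ∈ E) (he : ¬ CircuitRel M E e₁ e) :
    f ∉ C := by
  intro hfC
  obtain ⟨C₀, h₀, hC₀, hf₀⟩ := M.exists_isCircuit_of_mem_closure hf (fun h => hfE h.1)
  have heC₀ : e ∉ C₀ := fun h => by
    rcases h₀ h with rfl | h
    · exact hfE heE
    · exact he h.2
  obtain ⟨D, hD, hDc, heD⟩ := hC.strong_elimination hC₀ hfC hf₀ heC heC₀
  have hDE : D ⊆ E := by
    intro x hx
    have hx' := hD hx
    rcases hx'.1 with h | h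
    · exact (hCE h).resolve_left hx'.2
    · exact ((h₀ h).resolve_left hx'.2).1
  have hDC : D ⊆ C := by
    intro x hx
    have hx' := hD hx
    refine hx'.1.resolve_right fun h => he ?_
    have h1 := ((h₀ h).resolve_left hx'.2).2
    exact h1.trans (Or.inr ⟨D, hDE, hDc, hx, heD⟩)
  have := hDc.eq_of_subset_isCircuit hC hDC
  subst this
  exact (hD hfC).2 rfl

theorem circuitRel_insert_iff [Finite α] {M : Matroid α} {E : Set α} {e₁ e g : α} {f : α}
    (hfE : f ∉ E) (hf : f ∈ M.closure (circuitClass M E e₁)) (heE : e ∈ E)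
    (he : ¬ CircuitRel M E e₁ e) (hg : g ∈ insert f E) :
    CircuitRel M (insert f E) e g ↔ g ∈ E ∧ CircuitRel M E e g := by
  constructor
  · rintro (rfl | ⟨C, hCE, hC, heC, hgC⟩)
    · exact ⟨heE, Or.inl rfl⟩
    · have hfC := not_mem_of_isCircuit_insert hfE hf hC hCE heC heE he
      have hCE' : C ⊆ E := (Set.subset_insert_iff_of_notMem hfC).1 hCE
      exact ⟨hCE' hgC, Or.inr ⟨C, hCE', hC, heC, hgC⟩⟩
  · exact fun h => h.2.mono (Set.subset_insert _ _)

theorem circuitClass_insert_of_not_rel [Finite α] {M : Matroid α} {E : Set α} {e₁ e f : α}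
    (hfE : f ∉ E) (hf : f ∈ M.closure (circuitClass M E e₁)) (heE : e ∈ E)
    (he : ¬ CircuitRel M E e₁ e) :
    circuitClass M (insert f E) e = circuitClass M E e := by
  ext g
  constructor
  · rintro ⟨hg, h⟩
    exact (circuitRel_insert_iff hfE hf heE he hg).1 h
  · rintro ⟨hg, h⟩
    exact ⟨Or.inr hg, h.mono (Set.subset_insert _ _)⟩

theorem circuitClass_insert_self [Finite α] {M : Matroid α} {E : Set α} {e₁ f : α}
    (hfE : f ∉ E) (hf : f ∈ M.closure (circuitClass M E e₁)) (hloop : ¬ M.IsCircuit {f}) :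
    circuitClass M (insert f E) f = insert f (circuitClass M E e₁) ∧
      CircuitRel M (insert f E) f e₁ := by
  obtain ⟨C₀, h₀, hC₀, hf₀⟩ := M.exists_isCircuit_of_mem_closure hf (fun h => hfE h.1)
  obtain ⟨e₀, he₀, hne⟩ : ∃ e₀ ∈ C₀, e₀ ≠ f := by
    by_contra! h
    exact hloop ((Set.eq_singleton_iff_unique_mem.2 ⟨hf₀, h⟩) ▸ hC₀)
  have h1 : CircuitRel M E e₁ e₀ := ((h₀ he₀).resolve_left hne).2
  have hf1 : CircuitRel M (insert f E) f e₁ := by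
    refine CircuitRel.trans (Or.inr ⟨C₀, ?_, hC₀, hf₀, he₀⟩)
      (h1.symm.mono (Set.subset_insert _ _))
    exact h₀.trans (Set.insert_subset_insert fun x hx => hx.1)
  refine ⟨?_, hf1⟩
  ext g
  constructor
  · rintro ⟨hg, h⟩
    rcases hg with rfl | hg
    · exact Or.inl rfl
    refine Or.inr ⟨hg, ?_⟩
    by_contra hcon
    have := (circuitRel_insert_iff hfE hf hg hcon (Set.mem_insert f E)).1 h.symm
    exact hfE this.1
  · rintro (rfl | hg)
    · exact ⟨Set.mem_insert _ _, Or.inl rfl⟩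
    · exact ⟨Or.inr hg.1, hf1.trans (hg.2.mono (Set.subset_insert _ _))⟩

/-- Adding an element `f` in the closure of a class of `E` adds `f` to that class and leaves the
other classes unchanged. -/
theorem setOf_circuitClass_insert [Finite α] {M : Matroid α} {E : Set α} {e₁ f : α}
    (hfE : f ∉ E) (hf : f ∈ M.closure (circuitClass M E e₁)) (hloop : ¬ M.IsCircuit {f}) :
    {F | ∃ e ∈ insert f E, F = circuitClass M (insert f E) e} =
      insert (insert f (circuitClass M E e₁))
        ({F | ∃ e ∈ E, F = circuitClass M E e} \ {circuitClass M E e₁}) := by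
  obtain ⟨hself, hrel⟩ := circuitClass_insert_self hfE hf hloop
  ext F
  constructor
  · rintro ⟨e, he, rfl⟩
    rcases he with rfl | he
    · exact Or.inl hself
    by_cases h : CircuitRel M E e₁ e
    · left
      rw [← hself]
      exact (circuitClass_eq (hrel.trans (h.mono (Set.subset_insert _ _)))).symm
    · right
      rw [circuitClass_insert_of_not_rel hfE hf he h]
      refine ⟨⟨e, he, rfl⟩, fun heq => h ?_⟩
      have : e ∈ circuitClass M E e₁ := by
        rw [← Set.mem_singleton_iff.1 heq]
        exact ⟨he, Or.inl rfl⟩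
      exact this.2
  · rintro (rfl | ⟨⟨e, he, rfl⟩, hne⟩)
    · exact ⟨f, Set.mem_insert _ _, hself.symm⟩
    · refine ⟨e, Or.inr he, (circuitClass_insert_of_not_rel hfE hf he fun h => hne ?_).symm⟩
      exact (circuitClass_eq h).symm

end MatroidConnectivity

section LinearMatroid

variable {α W : Type*} [AddCommGroup W] [Module ℝ W]

/-- The matroid of linear independence of a finite family of vectors. -/
def linMatroid [Finite α] (f : α → W) : Matroid α :=
  (IndepMatroid.ofFinite (Set.finite_univ (α := α)) (LinearIndepOn ℝ f)
    (linearIndepOn_empty ℝ f) (fun _ _ hJ hIJ => hJ.mono hIJ)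
    (by
      intro I J hI hJ hlt
      by_contra! hcon
      have hsub : f '' J ⊆ Submodule.span ℝ (f '' I) := by
        rintro _ ⟨e, he, rfl⟩
        by_contra hnot
        have heI : e ∉ I := fun h => hnot (Submodule.subset_span ⟨e, h, rfl⟩)
        exact hcon e he heI (hI.insert hnot)
      have hle := Submodule.span_le.2 hsub
      have hfin : (f '' I).Finite := Set.toFinite _
      have := FiniteDimensional.span_of_finite ℝ hfin
      have h1 := Submodule.finrank_mono hle
      have card (K : Set α) (hK : LinearIndepOn ℝ f K) :
          Module.finrank ℝ (Submodule.span ℝ (f '' K)) = K.ncard := by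
        have := Fintype.ofFinite K
        rw [Set.image_eq_range, ← Nat.card_coe_set_eq, Nat.card_eq_fintype_card]
        exact finrank_span_eq_card hK.linearIndependent
      rw [card _ hI, card _ hJ] at h1
      omega)
    (fun _ _ => Set.subset_univ _)).matroid

@[simp]
theorem linMatroid_indep [Finite α] {f : α → W} {I : Set α} :
    (linMatroid f).Indep I ↔ LinearIndepOn ℝ f I := Iff.rfl

theorem linMatroid_ground [Finite α] (f : α → W) : (linMatroid f).E = Set.univ := rfl

theorem linMatroid_isCircuit_iff [Finite α] {f : α → W} {C : Set α} :
    (linMatroid f).IsCircuit C ↔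
      ¬ LinearIndepOn ℝ f C ∧ ∀ C', C' ⊂ C → LinearIndepOn ℝ f C' := by
  rw [Matroid.isCircuit_iff_forall_ssubset, Matroid.Dep]
  simp [linMatroid_ground]

theorem linMatroid_isCircuit_mem_span [Finite α] {f : α → W} {C : Set α} {e : α}
    (hC : (linMatroid f).IsCircuit C) (he : e ∈ C) :
    f e ∈ Submodule.span ℝ (f '' (C \ {e})) := by
  have h := hC.not_indep
  have h' := hC.sdiff_singleton_indep he
  rw [linMatroid_indep] at h h'
  rw [h'.mem_span_iff]
  intro h2
  rw [Set.insert_sdiff_self_of_mem he] at h2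
  exact absurd h2 h

theorem mem_linMatroid_closure [Finite α] {f : α → W} {X : Set α} {e : α}
    (h : f e ∈ Submodule.span ℝ (f '' X)) : e ∈ (linMatroid f).closure X := by
  obtain ⟨I, hI⟩ := (linMatroid f).exists_isBasis X (by simp [linMatroid_ground])
  rw [← hI.closure_eq_closure]
  have hIi : LinearIndepOn ℝ f I := hI.indep
  have hX : Submodule.span ℝ (f '' X) ≤ Submodule.span ℝ (f '' I) := by
    rw [Submodule.span_le]
    rintro _ ⟨x, hx, rfl⟩
    rw [SetLike.mem_coe, hIi.mem_span_iff]
    intro h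
    exact hI.mem_of_insert_indep hx h
  have he := hX h
  rw [hIi.mem_span_iff] at he
  rw [hI.indep.mem_closure_iff]
  by_cases h : e ∈ I
  · exact Or.inr h
  · refine Or.inl ⟨fun h' => h (he h'), by simp [linMatroid_ground]⟩

end LinearMatroid


section Rows

variable [DecidableEq V]

theorem edgeVec_apply {d : ℕ} (p : V → Fin d → ℝ) (a b : V) (wi : V × Fin d) :
    edgeVec p a b wi = (if wi.1 = a then p a wi.2 - p b wi.2 else 0) +
      (if wi.1 = b then p b wi.2 - p a wi.2 else 0) := by
  unfold edgeVec
  split_ifs with h1 h2 h2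
  · rw [← h1, ← h2]; simp
  · simp
  · simp
  · simp

theorem edgeVec_comm {d : ℕ} (p : V → Fin d → ℝ) (a b : V) : edgeVec p a b = edgeVec p b a := by
  ext wi
  rw [edgeVec_apply, edgeVec_apply, add_comm]

/-- The row of the planar rigidity matrix indexed by an unordered pair. -/
def row (p : V → Fin 2 → ℝ) : Sym2 V → (V × Fin 2 → ℝ) :=
  Sym2.lift ⟨edgeVec p, edgeVec_comm p⟩

@[simp]
theorem row_mk (p : V → Fin 2 → ℝ) (a b : V) : row p s(a, b) = edgeVec p a b := rfl

/-- The first-order change of the squared length of `ab` under the velocity field `m`,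
up to a factor of two. -/
def strain {V : Type*} (p m : V → Fin 2 → ℝ) (a b : V) : ℝ :=
  (p a 0 - p b 0) * (m a 0 - m b 0) + (p a 1 - p b 1) * (m a 1 - m b 1)

theorem sum_row_mul [Fintype V] (p m : V → Fin 2 → ℝ) (a b : V) :
    ∑ wi, row p s(a, b) wi * m wi.1 wi.2 = strain p m a b := by
  simp only [row_mk, edgeVec_apply, Fintype.sum_prod_type, Fin.sum_univ_two, add_mul, ite_mul,
    zero_mul, Finset.sum_add_distrib, Finset.sum_ite_eq', Finset.mem_univ, if_true, strain]
  ring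

/-- An infinitesimal motion of the framework with edge set `F` and placement `p`. -/
def Motion {V : Type*} (p : V → Fin 2 → ℝ) (F : Set (Sym2 V)) (m : V → Fin 2 → ℝ) : Prop :=
  ∀ x y, s(x, y) ∈ F → strain p m x y = 0

theorem row_mem_span_iff [Fintype V] {p : V → Fin 2 → ℝ} {F : Set (Sym2 V)} {a b : V} :
    row p s(a, b) ∈ Submodule.span ℝ (row p '' F) ↔
      ∀ m, Motion p F m → strain p m a b = 0 := by
  constructor
  · intro h m hm
    let φ : (V × Fin 2 → ℝ) →ₗ[ℝ] ℝ := ∑ wi, (m wi.1 wi.2) • LinearMap.proj wi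
    have hφ (x y : V) : φ (row p s(x, y)) = strain p m x y := by
      rw [← sum_row_mul]
      simp [φ, mul_comm]
    have hle : Submodule.span ℝ (row p '' F) ≤ LinearMap.ker φ := by
      rw [Submodule.span_le]
      rintro _ ⟨e, he, rfl⟩
      induction e with
      | _ x y => exact (hφ x y).trans (hm x y he)
    rw [← hφ]
    exact hle h
  · intro h
    by_contra hnot
    obtain ⟨f, hf, hle⟩ := Submodule.exists_le_ker_of_notMem hnot
    have hφ (x y : V) : f (row p s(x, y)) =
        strain p (fun w i => f (Pi.single (w, i) 1)) x y := by
      rw [← sum_row_mul, LinearMap.pi_apply_eq_sum_univ f]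
      refine Finset.sum_congr rfl fun wi _ => ?_
      rw [smul_eq_mul]
      congr 2
      ext j
      simp [Pi.single_apply, eq_comm]
    refine hf ((hφ a b).trans (h _ fun x y hxy => ?_))
    rw [← hφ]
    exact hle (Submodule.subset_span ⟨_, hxy, rfl⟩)

end Rows

section Generic

theorem linearIndepOn_iff_finrank_eq_ncard {α W : Type*} [AddCommGroup W] [Module ℝ W]
    [Finite α] {f : α → W} {K : Set α} :
    LinearIndepOn ℝ f K ↔ Module.finrank ℝ (Submodule.span ℝ (f '' K)) = K.ncard := by
  have := Fintype.ofFinite K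
  rw [Set.image_eq_range, ← Nat.card_coe_set_eq, Nat.card_eq_fintype_card, LinearIndepOn,
    linearIndependent_iff_card_eq_finrank_span, eq_comm]
  rfl

/-- `P` holds on a nonempty Zariski open set of planar placements. -/
def GenericallyTrue (P : (V → Fin 2 → ℝ) → Prop) : Prop :=
  ∃ Q : MvPolynomial (V × Fin 2) ℝ, Q ≠ 0 ∧
    ∀ p : V → Fin 2 → ℝ, MvPolynomial.eval (fun x => p x.1 x.2) Q ≠ 0 → P p

theorem GenericallyTrue.of_forall {P : (V → Fin 2 → ℝ) → Prop} (h : ∀ p, P p) :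
    GenericallyTrue P := ⟨1, one_ne_zero, fun p _ => h p⟩

theorem GenericallyTrue.of_exists {P : (V → Fin 2 → ℝ) → Prop} (Q : MvPolynomial (V × Fin 2) ℝ)
    (q : V → Fin 2 → ℝ) (hq : MvPolynomial.eval (fun x => q x.1 x.2) Q ≠ 0)
    (h : ∀ p : V → Fin 2 → ℝ, MvPolynomial.eval (fun x => p x.1 x.2) Q ≠ 0 → P p) :
    GenericallyTrue P :=
  ⟨Q, fun h0 => hq (by rw [h0, map_zero]), h⟩

theorem GenericallyTrue.imp {A : Prop} {P : (V → Fin 2 → ℝ) → Prop}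
    (h : A → GenericallyTrue P) : GenericallyTrue fun p => A → P p := by
  by_cases hA : A
  · obtain ⟨Q, hQ, hP⟩ := h hA
    exact ⟨Q, hQ, fun p hp _ => hP p hp⟩
  · exact .of_forall fun p h => absurd h hA

theorem GenericallyTrue.forall {ι : Type*} [Finite ι] {P : ι → (V → Fin 2 → ℝ) → Prop}
    (h : ∀ i, GenericallyTrue (P i)) : GenericallyTrue fun p => ∀ i, P i p := by
  have := Fintype.ofFinite ι
  choose Q hQ hP using h
  refine ⟨∏ i, Q i, Finset.prod_ne_zero_iff.2 fun i _ => hQ i, fun p hp i => hP i p ?_⟩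
  rw [map_prod, Finset.prod_ne_zero_iff] at hp
  exact hp i (Finset.mem_univ i)

theorem GenericallyTrue.and {P R : (V → Fin 2 → ℝ) → Prop} (hP : GenericallyTrue P)
    (hR : GenericallyTrue R) : GenericallyTrue fun p => P p ∧ R p := by
  obtain ⟨Q, hQ, hP⟩ := hP
  obtain ⟨Q', hQ', hR⟩ := hR
  refine ⟨Q * Q', mul_ne_zero hQ hQ', fun p hp => ?_⟩
  rw [map_mul] at hp
  exact ⟨hP p (left_ne_zero_of_mul hp), hR p (right_ne_zero_of_mul hp)⟩

theorem GenericallyTrue.exists {P : (V → Fin 2 → ℝ) → Prop} (hP : GenericallyTrue P) :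
    ∃ p, P p := by
  obtain ⟨Q, hQ, hP⟩ := hP
  by_contra! hcon
  refine hQ (MvPolynomial.funext fun x => ?_)
  by_contra hx
  rw [map_zero] at hx
  exact hcon (fun w i => x (w, i)) (hP _ hx)

/-- Twice the signed area of the triangle `abc`. -/
def area (p : V → Fin 2 → ℝ) (a b c : V) : ℝ :=
  (p b 0 - p a 0) * (p c 1 - p a 1) - (p b 1 - p a 1) * (p c 0 - p a 0)

/-- A placement in sufficiently general position for the planar rigidity matroid. -/
structure GenPos [DecidableEq V] (p : V → Fin 2 → ℝ) : Prop where
  ne : ∀ a b, a ≠ b → p a 0 ≠ p b 0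
  area_ne : ∀ a b c, a ≠ b ∧ a ≠ c ∧ b ≠ c → area p a b c ≠ 0
  indep : ∀ (I : Set (Sym2 V)) (q : V → Fin 2 → ℝ),
    LinearIndepOn ℝ (row q) I → LinearIndepOn ℝ (row p) I

open MvPolynomial in
theorem exists_eval_eq_row [DecidableEq V] (e : Sym2 V) (wi : V × Fin 2) :
    ∃ Q : MvPolynomial (V × Fin 2) ℝ, ∀ p : V → Fin 2 → ℝ,
      eval (fun x => p x.1 x.2) Q = row p e wi := by
  induction e with
  | _ a b =>
    refine ⟨(if wi.1 = a then X (a, wi.2) - X (b, wi.2) else 0) +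
      (if wi.1 = b then X (b, wi.2) - X (a, wi.2) else 0), fun p => ?_⟩
    rw [row_mk, edgeVec_apply]
    split_ifs <;> simp

theorem det_mul_transpose_ne_zero_iff {m n : Type*} [Fintype m] [DecidableEq m] [Fintype n]
    (A : Matrix m n ℝ) : (A * A.transpose).det ≠ 0 ↔ LinearIndependent ℝ A.row := by
  rw [linearIndependent_iff_card_eq_finrank_span, Set.finrank,
    ← Matrix.rank_eq_finrank_span_row, ← Matrix.rank_self_mul_transpose]
  constructor
  · intro h
    exact (Matrix.rank_of_isUnit _ ((Matrix.isUnit_iff_isUnit_det _).2 h.isUnit)).symm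
  · intro h
    rw [← isUnit_iff_ne_zero, ← Matrix.isUnit_iff_isUnit_det,
      ← Matrix.linearIndependent_rows_iff_isUnit, linearIndependent_iff_card_eq_finrank_span,
      Set.finrank, ← Matrix.rank_eq_finrank_span_row]
    exact h

theorem genericallyTrue_indep [Fintype V] [DecidableEq V] (I : Set (Sym2 V))
    (q : V → Fin 2 → ℝ) (hq : LinearIndepOn ℝ (row q) I) :
    GenericallyTrue fun p => LinearIndepOn ℝ (row p) I := by
  classical
  have := Fintype.ofFinite I
  choose Q hQ using exists_eval_eq_row (V := V)
  let A : Matrix I (V × Fin 2) (MvPolynomial (V × Fin 2) ℝ) := Matrix.of fun e wi => Q e wi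
  have key (p : V → Fin 2 → ℝ) :
      MvPolynomial.eval (fun x => p x.1 x.2) (A * A.transpose).det ≠ 0 ↔
        LinearIndepOn ℝ (row p) I := by
    rw [RingHom.map_det, RingHom.mapMatrix_apply, Matrix.map_mul, Matrix.transpose_map,
      det_mul_transpose_ne_zero_iff, LinearIndepOn]
    have hA : (A.map (MvPolynomial.eval fun x => p x.1 x.2)).row = fun e : I => row p e := by
      ext e wi
      simp [A, hQ, Matrix.row]
    rw [hA]
  exact .of_exists _ q ((key q).2 hq) fun p hp => (key p).1 hp

open MvPolynomial in
theorem exists_genPos [Fintype V] [DecidableEq V] : ∃ p : V → Fin 2 → ℝ, GenPos p := by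
  have h1 : GenericallyTrue fun p : V → Fin 2 → ℝ => ∀ a b, a ≠ b → p a 0 ≠ p b 0 := by
    refine .forall fun a => .forall fun b => .imp fun hab => ?_
    refine .of_exists (X (a, 0) - X (b, 0)) (fun w _ => if w = a then 1 else 0) ?_ fun p hp => ?_
    · simp [hab.symm]
    · simpa [sub_eq_zero] using hp
  have h2 : GenericallyTrue fun p : V → Fin 2 → ℝ => ∀ a b c, a ≠ b ∧ a ≠ c ∧ b ≠ c →
      area p a b c ≠ 0 := by
    refine .forall fun a => .forall fun b => .forall fun c => .imp fun ⟨hab, hac, hbc⟩ => ?_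
    refine .of_exists ((X (b, 0) - X (a, 0)) * (X (c, 1) - X (a, 1)) -
      (X (b, 1) - X (a, 1)) * (X (c, 0) - X (a, 0)))
      (fun w => if w = b then ![1, 0] else if w = c then ![0, 1] else 0) ?_ fun p hp => ?_
    · simp [hab, hac, hbc.symm]
    · simpa [area] using hp
  have h3 : GenericallyTrue fun p : V → Fin 2 → ℝ => ∀ I : Set (Sym2 V),
      (∃ q, LinearIndepOn ℝ (row q) I) → LinearIndepOn ℝ (row p) I := by
    exact .forall fun I => .imp fun ⟨q, hq⟩ => genericallyTrue_indep I q hq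
  obtain ⟨p, ⟨hp1, hp2⟩, hp3⟩ := ((h1.and h2).and h3).exists
  exact ⟨p, hp1, hp2, fun I q hq => hp3 I ⟨q, hq⟩⟩

theorem rankAt_two [DecidableEq V] (q : V → Fin 2 → ℝ) (F : Set (Sym2 V)) :
    rankAt 2 q F = Module.finrank ℝ (Submodule.span ℝ (row q '' F)) := by
  suffices h : {x | ∃ u v, s(u, v) ∈ F ∧ x = edgeVec q u v} = row q '' F by rw [rankAt, h]
  ext x
  constructor
  · rintro ⟨u, v, h, rfl⟩
    exact ⟨_, h, rfl⟩
  · rintro ⟨e, he, rfl⟩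
    induction e with
    | _ u v => exact ⟨u, v, he, rfl⟩

theorem GenPos.rdIndep_iff [Fintype V] [DecidableEq V] {p : V → Fin 2 → ℝ} (hp : GenPos p)
    {F : Set (Sym2 V)} : RdIndep 2 F ↔ LinearIndepOn ℝ (row p) F := by
  have hle (n : ℕ) (hn : ∃ q : V → Fin 2 → ℝ, n = rankAt 2 q F) : n ≤ F.ncard := by
    obtain ⟨q, rfl⟩ := hn
    have := Fintype.ofFinite F
    rw [rankAt_two, Set.image_eq_range, ← Nat.card_coe_set_eq, Nat.card_eq_fintype_card]
    exact finrank_range_le_card _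
  have hbdd : BddAbove {n : ℕ | ∃ q : V → Fin 2 → ℝ, n = rankAt 2 q F} := ⟨_, hle⟩
  constructor
  · intro h
    obtain ⟨q, hq⟩ := Nat.sSup_mem (s := {n : ℕ | ∃ q : V → Fin 2 → ℝ, n = rankAt 2 q F})
      ⟨_, p, rfl⟩ hbdd
    refine hp.indep F q (linearIndepOn_iff_finrank_eq_ncard.2 ?_)
    rw [← rankAt_two, ← hq]
    exact h
  · intro h
    refine le_antisymm (csSup_le ⟨_, p, rfl⟩ hle) (le_csSup hbdd ⟨p, ?_⟩)
    rw [rankAt_two, linearIndepOn_iff_finrank_eq_ncard.1 h]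

theorem GenPos.rdCircuit_iff [Fintype V] [DecidableEq V] {p : V → Fin 2 → ℝ} (hp : GenPos p)
    {C : Set (Sym2 V)} : RdCircuit 2 C ↔ (linMatroid (row p)).IsCircuit C := by
  simp only [RdCircuit, hp.rdIndep_iff, linMatroid_isCircuit_iff]

theorem GenPos.isRdComponent_iff [Fintype V] [DecidableEq V] {p : V → Fin 2 → ℝ} (hp : GenPos p)
    {G : SimpleGraph V} {F : Set (Sym2 V)} : IsRdComponent 2 G F ↔
      ∃ e ∈ G.edgeSet, F = circuitClass (linMatroid (row p)) G.edgeSet e := by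
  simp only [IsRdComponent, circuitClass, CircuitRel, RdCircuitOf, hp.rdCircuit_iff, and_assoc]

end Generic


section Strain

variable {p m : V → Fin 2 → ℝ} {a b x : V}

theorem strain_comm (p m : V → Fin 2 → ℝ) (a b : V) : strain p m a b = strain p m b a := by
  unfold strain; ring

@[simp]
theorem strain_self (p m : V → Fin 2 → ℝ) (a : V) : strain p m a a = 0 := by
  simp [strain]

theorem strain_eq_zero_of_eq (h : m a = m b) : strain p m a b = 0 := by
  simp [strain, h]

theorem strain_congr {q n : V → Fin 2 → ℝ} (ha : p a = q a) (hb : p b = q b) (hma : m a = n a)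
    (hmb : m b = n b) : strain p m a b = strain q n a b := by
  simp [strain, ha, hb, hma, hmb]

theorem Motion.mono {F F' : Set (Sym2 V)} (h : Motion p F' m) (hF : F ⊆ F') : Motion p F m :=
  fun x y hxy => h x y (hF hxy)

/-- Subtracting a rigid motion, one may assume that two given points are fixed. -/
theorem exists_normalized (hab : p a 0 ≠ p b 0) (h : strain p m a b = 0) :
    ∃ n, (∀ x y, strain p n x y = strain p m x y) ∧ n a = 0 ∧ n b = 0 := by
  have hne : p b 0 - p a 0 ≠ 0 := sub_ne_zero.2 hab.symm
  obtain ⟨s, hs⟩ : ∃ s, s * (p b 0 - p a 0) = m b 1 - m a 1 := ⟨_, div_mul_cancel₀ _ hne⟩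
  refine ⟨fun x => ![m x 0 - m a 0 + s * (p x 1 - p a 1), m x 1 - m a 1 - s * (p x 0 - p a 0)],
    fun x y => ?_, ?_, ?_⟩
  · simp [strain]
    ring
  · ext i
    fin_cases i <;> simp
  · ext i
    fin_cases i
    · simp only [strain] at h
      have : (p b 0 - p a 0) * (m b 0 - m a 0 + s * (p b 1 - p a 1)) = 0 := by
        linear_combination h + (p b 1 - p a 1) * hs
      simpa using (mul_eq_zero.1 this).resolve_left hne
    · simp
      linarith

variable [DecidableEq V]

theorem GenPos.eq_zero_of_strain (hp : GenPos p) (hab : a ≠ b) (ha : m a = 0) (hb : m b = 0)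
    (hxa : strain p m x a = 0) (hxb : strain p m x b = 0) : m x = 0 := by
  by_cases h1 : x = a
  · rw [h1, ha]
  by_cases h2 : x = b
  · rw [h2, hb]
  have hA := hp.area_ne x a b ⟨h1, h2, hab⟩
  simp only [strain, ha, hb, Pi.zero_apply, sub_zero] at hxa hxb
  unfold area at hA
  ext i
  fin_cases i
  · refine (mul_eq_zero.1 (?_ : _ * m x 0 = 0)).resolve_left hA
    linear_combination (p x 1 - p b 1) * hxa - (p x 1 - p a 1) * hxb
  · refine (mul_eq_zero.1 (?_ : _ * m x 1 = 0)).resolve_left hA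
    linear_combination (p x 0 - p a 0) * hxb - (p x 0 - p b 0) * hxa

theorem motion_of_star {F : Set (Sym2 V)} {v : V}
    (h1 : ∀ y, y ≠ v → s(v, y) ∈ F → strain p m v y = 0)
    (h2 : ∀ x y, x ≠ v → y ≠ v → s(x, y) ∈ F → strain p m x y = 0) : Motion p F m := by
  intro x y hxy
  by_cases hx : x = v
  · subst hx
    by_cases hy : y = x
    · subst hy; simp
    · exact h1 y hy hxy
  · by_cases hy : y = v
    · subst hy
      rw [strain_comm]
      exact h1 x hx (Sym2.eq_swap ▸ hxy)
    · exact h2 x y hx hy hxy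

theorem strain_update_zero {z : Fin 2 → ℝ} {v y : V} (hy : y ≠ v) :
    strain p (Function.update 0 v z) v y =
      (p v 0 - p y 0) * z 0 + (p v 1 - p y 1) * z 1 := by
  simp [strain, hy]

theorem strain_update_of_ne {n : V → Fin 2 → ℝ} {z : Fin 2 → ℝ} {v x y : V} (hx : x ≠ v)
    (hy : y ≠ v) : strain p (Function.update n v z) x y = strain p n x y := by
  simp [strain, hx, hy]

theorem motion_update_zero {F : Set (Sym2 V)} {z : Fin 2 → ℝ} {v : V}
    (h : ∀ y, y ≠ v → s(v, y) ∈ F → (p v 0 - p y 0) * z 0 + (p v 1 - p y 1) * z 1 = 0) :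
    Motion p F (Function.update 0 v z) :=
  motion_of_star (fun y hy hF => (strain_update_zero hy).trans (h y hy hF))
    fun x y hx hy _ => by rw [strain_update_of_ne hx hy]; simp [strain]

end Strain

section CircuitDegree

variable [Fintype V] [DecidableEq V]

theorem ncard_add_two_le_of_linearIndepOn {p : V → Fin 2 → ℝ} {I : Set (Sym2 V)} {X : Set V} {v : V}
    (hI : LinearIndepOn ℝ (row p) I) (hv : v ∈ X) (hX : vertexSpan I ⊆ X) :
    I.ncard + 2 ≤ 2 * X.ncard := by
  classical
  let ρ : (V × Fin 2 → ℝ) →ₗ[ℝ] (((X \ {v} : Set V) × Fin 2) → ℝ) :=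
    LinearMap.funLeft ℝ ℝ fun wi => (wi.1.1, wi.2)
  have key : ∀ x ∈ Submodule.span ℝ (row p '' I),
      (∀ w ∉ X, ∀ i, x (w, i) = 0) ∧ ∀ i, ∑ w, x (w, i) = 0 := by
    intro x hx
    induction hx using Submodule.span_induction with
    | mem x hx =>
      obtain ⟨e, he, rfl⟩ := hx
      induction e with
      | _ a b =>
        have ha : a ∈ X := hX ⟨_, he, Sym2.mem_mk_left a b⟩
        have hb : b ∈ X := hX ⟨_, he, Sym2.mem_mk_right a b⟩
        constructor
        · intro w hw i
          have h1 : w ≠ a := fun h => hw (h ▸ ha)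
          have h2 : w ≠ b := fun h => hw (h ▸ hb)
          simp [edgeVec_apply, h1, h2]
        · intro i
          simp [edgeVec_apply, Finset.sum_add_distrib]
    | zero => simp
    | add x y _ _ hx hy =>
      refine ⟨fun w hw i => ?_, fun i => ?_⟩
      · simp [hx.1 w hw i, hy.1 w hw i]
      · simp [Finset.sum_add_distrib, hx.2 i, hy.2 i]
    | smul c x _ hx =>
      refine ⟨fun w hw i => ?_, fun i => ?_⟩
      · simp [hx.1 w hw i]
      · simp [← Finset.mul_sum, hx.2 i]
  have hinj : Function.Injective (ρ.domRestrict (Submodule.span ℝ (row p '' I))) := by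
    rw [injective_iff_map_eq_zero]
    rintro ⟨x, hx⟩ h0
    obtain ⟨h1, h2⟩ := key x hx
    have h3 (w : V) (hw : w ≠ v) (i : Fin 2) : x (w, i) = 0 := by
      by_cases hwX : w ∈ X
      · exact congrFun h0 (⟨w, hwX, hw⟩, i)
      · exact h1 w hwX i
    ext ⟨w, i⟩
    by_cases hw : w = v
    · subst hw
      have := h2 i
      rwa [Finset.sum_eq_single w (fun b _ hb => h3 b hb i) (by simp)] at this
    · exact h3 w hw i
  have h := LinearMap.finrank_le_finrank_of_injective hinj
  rw [linearIndepOn_iff_finrank_eq_ncard.1 hI, Module.finrank_fintype_fun_eq_card,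
    Fintype.card_prod, Fintype.card_fin, ← Nat.card_eq_fintype_card, Nat.card_coe_set_eq] at h
  have := Set.ncard_sdiff_singleton_add_one hv (Set.toFinite X)
  omega

theorem exists_degree_le_three {p : V → Fin 2 → ℝ} {C : Set (Sym2 V)}
    (hC : (linMatroid (row p)).IsCircuit C) (hd : ∀ e ∈ C, ¬ e.IsDiag) :
    ∃ v ∈ vertexSpan C, {w | s(v, w) ∈ C}.ncard ≤ 3 := by
  classical
  by_contra! hcon
  obtain ⟨e, he⟩ := hC.nonempty
  have hI : LinearIndepOn ℝ (row p) (C \ {e}) := hC.sdiff_singleton_indep he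
  have hv : e.out.1 ∈ vertexSpan C := ⟨e, he, e.out_fst_mem⟩
  have h1 := ncard_add_two_le_of_linearIndepOn hI hv
    fun w ⟨f, hf, hw⟩ => ⟨f, hf.1, hw⟩
  have h2 := Set.ncard_sdiff_singleton_add_one he (Set.toFinite C)
  have hsum := Finset.sum_card_bipartiteAbove_eq_sum_card_bipartiteBelow
    (s := C.toFinset) (t := (vertexSpan C).toFinset) (fun (e : Sym2 V) w => w ∈ e)
  have h3 : ∀ e ∈ C.toFinset, (Finset.bipartiteAbove (fun (e : Sym2 V) w => w ∈ e)
      (vertexSpan C).toFinset e).card = 2 := by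
    intro e he
    rw [Set.mem_toFinset] at he
    rw [← Sym2.card_toFinset_of_not_isDiag e (hd e he)]
    congr 1
    ext w
    simp only [Finset.mem_bipartiteAbove, Set.mem_toFinset, Sym2.mem_toFinset]
    exact ⟨fun h => h.2, fun h => ⟨⟨e, he, h⟩, h⟩⟩
  have h4 : ∀ w ∈ (vertexSpan C).toFinset, 4 ≤ (Finset.bipartiteBelow
      (fun (e : Sym2 V) w => w ∈ e) C.toFinset w).card := by
    intro w hw
    refine (Nat.succ_le_of_lt (hcon w (Set.mem_toFinset.1 hw))).trans ?_
    rw [← Set.ncard_coe_finset, ← Set.ncard_image_of_injective {x | s(w, x) ∈ C}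
      (f := fun x => s(w, x)) (fun x y h => Sym2.congr_right.1 h)]
    refine Set.ncard_le_ncard ?_ (Finset.finite_toSet _)
    rintro _ ⟨x, hx, rfl⟩
    simpa using hx
  rw [Finset.sum_congr rfl h3] at hsum
  have h5 := Finset.sum_le_sum h4
  rw [← hsum] at h5
  simp only [Finset.sum_const, smul_eq_mul, Set.toFinset_card, ← Nat.card_eq_fintype_card,
    Nat.card_coe_set_eq] at h5
  omega

end CircuitDegree


section Rigidity

/-- Every infinitesimal motion of `F` preserves all distances within `X` to first order. -/
def Rigid (p : V → Fin 2 → ℝ) (F : Set (Sym2 V)) (X : Set V) : Prop :=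
  ∀ m, Motion p F m → ∀ a ∈ X, ∀ b ∈ X, strain p m a b = 0

variable [DecidableEq V] {p : V → Fin 2 → ℝ} {C : Set (Sym2 V)}

theorem Rigid.eq_zero (hp : GenPos p) {A : Set (Sym2 V)} {X : Set V} (hA : Rigid p A X)
    {m : V → Fin 2 → ℝ} (hm : Motion p A m) {a b x : V} (hab : a ≠ b) (ha : a ∈ X) (hb : b ∈ X)
    (hx : x ∈ X) (hma : m a = 0) (hmb : m b = 0) : m x = 0 :=
  hp.eq_zero_of_strain hab hma hmb (hA m hm x hx a ha) (hA m hm x hx b hb)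

variable [Fintype V]

theorem strain_eq_zero_of_isCircuit (hC : (linMatroid (row p)).IsCircuit C) {a b : V}
    (hab : s(a, b) ∈ C) {m : V → Fin 2 → ℝ} (hm : Motion p (C \ {s(a, b)}) m) :
    strain p m a b = 0 :=
  row_mem_span_iff.1 (linMatroid_isCircuit_mem_span hC hab) m hm

theorem isCircuit_star_ne_singleton (hp : GenPos p) (hC : (linMatroid (row p)).IsCircuit C)
    {v a : V} (hva : v ≠ a) : {w | s(v, w) ∈ C} ≠ {a} := by
  intro h
  have ha : s(v, a) ∈ C := (Set.ext_iff.1 h a).2 rfl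
  have hm : Motion p (C \ {s(v, a)}) (Function.update 0 v (p v - p a)) := by
    refine motion_update_zero fun y hy hy' => ?_
    have : y ∈ {w | s(v, w) ∈ C} := hy'.1
    rw [h] at this
    exact absurd (by rw [Set.mem_singleton_iff.1 this]; rfl) hy'.2
  have h0 := strain_eq_zero_of_isCircuit hC ha hm
  rw [strain_update_zero hva.symm] at h0
  have := hp.ne v a hva
  have h1 : 0 < (p v 0 - p a 0) * (p v 0 - p a 0) := mul_self_pos.2 (sub_ne_zero.2 this)
  have h2 := mul_self_nonneg (p v 1 - p a 1)
  simp only [Pi.sub_apply] at h0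
  linarith

theorem isCircuit_star_ne_pair (hp : GenPos p) (hC : (linMatroid (row p)).IsCircuit C)
    {v a b : V} (hva : v ≠ a) (hvb : v ≠ b) (hab : a ≠ b) : {w | s(v, w) ∈ C} ≠ {a, b} := by
  intro h
  have ha : s(v, a) ∈ C := (Set.ext_iff.1 h a).2 (Or.inl rfl)
  have hm : Motion p (C \ {s(v, a)})
      (Function.update 0 v ![p v 1 - p b 1, -(p v 0 - p b 0)]) := by
    refine motion_update_zero fun y hy hy' => ?_
    have : y ∈ {w | s(v, w) ∈ C} := hy'.1
    rw [h] at this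
    rcases this with rfl | this
    · exact absurd rfl hy'.2
    · rw [Set.mem_singleton_iff.1 this]
      simp
      ring
  have h0 := strain_eq_zero_of_isCircuit hC ha hm
  rw [strain_update_zero hva.symm] at h0
  refine hp.area_ne v a b ⟨hva, hvb, hab⟩ ?_
  simp only [Matrix.cons_val_zero, Matrix.cons_val_one] at h0
  unfold area
  linear_combination h0

/-- The 1-extension argument: at a vertex of degree three of a circuit, the edges avoiding the
vertex span each pair of neighbours. -/
theorem strain_eq_zero_of_degree_three (hp : GenPos p) (hC : (linMatroid (row p)).IsCircuit C)
    {v a b c : V} (hva : v ≠ a) (hvb : v ≠ b) (hvc : v ≠ c) (hab : a ≠ b) (hac : a ≠ c)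
    (hbc : b ≠ c) (h : {w | s(v, w) ∈ C} = {a, b, c}) {n : V → Fin 2 → ℝ}
    (hn : Motion p {e | e ∈ C ∧ v ∉ e} n) : strain p n a b = 0 := by
  by_contra hab0
  set C₀ : Set (Sym2 V) := {e | e ∈ C ∧ v ∉ e} with hC₀
  have hmem (w : V) : s(v, w) ∈ C ↔ w = a ∨ w = b ∨ w = c := Set.ext_iff.1 h w
  have hCeq : C = insert s(v, c) (insert s(v, b) (insert s(v, a) C₀)) := by
    ext e
    by_cases hve : v ∈ e
    · obtain ⟨w, rfl⟩ := hve
      simp [hmem, hC₀]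
      tauto
    · have h1 (w : V) : e ≠ s(v, w) := fun h => hve (h ▸ Sym2.mem_mk_left v w)
      simp [hC₀, hve, h1]
  have hvC₀ (w : V) : s(v, w) ∉ C₀ := fun h => h.2 (Sym2.mem_mk_left v w)
  let q : V → Fin 2 → ℝ := Function.update p v fun i => (p a i + p b i) / 2
  have hqv (i : Fin 2) : q v i = (p a i + p b i) / 2 := by simp [q]
  have hq (w : V) (hw : w ≠ v) : q w = p w := by simp [q, hw]
  have hI₀ : LinearIndepOn ℝ (row q) C₀ := by
    have hss : C₀ ⊂ C := ⟨fun e he => he.1, fun hsub => hvC₀ a (hsub ((hmem a).2 (Or.inl rfl)))⟩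
    have : LinearIndepOn ℝ (row p) C₀ := hC.ssubset_indep hss
    refine this.congr fun e he => ?_
    induction e with
    | _ x y =>
      have hx : x ≠ v := fun h => he.2 (h ▸ Sym2.mem_mk_left x y)
      have hy : y ≠ v := fun h => he.2 (h ▸ Sym2.mem_mk_right x y)
      ext wi
      rw [row_mk, row_mk, edgeVec_apply, edgeVec_apply, hq x hx, hq y hy]
  have hnorm : 0 < (p b 0 - p a 0) * (p b 0 - p a 0) + (p b 1 - p a 1) * (p b 1 - p a 1) := by
    have h1 : 0 < (p b 0 - p a 0) * (p b 0 - p a 0) :=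
      mul_self_pos.2 (sub_ne_zero.2 (hp.ne b a hab.symm))
    have h2 := mul_self_nonneg (p b 1 - p a 1)
    linarith
  have hIa : LinearIndepOn ℝ (row q) (insert s(v, a) C₀) := by
    refine hI₀.insert fun hspan => ?_
    have hm : Motion q C₀ (Function.update 0 v (p b - p a)) :=
      motion_update_zero fun y hy hy' => absurd hy' (hvC₀ y)
    have h0 := row_mem_span_iff.1 hspan _ hm
    rw [strain_update_zero hva.symm, hqv, hqv, hq a hva.symm] at h0
    simp only [Pi.sub_apply] at h0
    linarith
  have hIb : LinearIndepOn ℝ (row q) (insert s(v, b) (insert s(v, a) C₀)) := by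
    refine hIa.insert fun hspan => ?_
    have hm : Motion q (insert s(v, a) C₀) (Function.update n v (n a)) := by
      refine motion_of_star (v := v) (fun y hy hy' => ?_) fun x y hx hy hxy => ?_
      · rcases hy' with hy' | hy'
        · rw [Sym2.congr_right.1 hy']
          exact strain_eq_zero_of_eq (by simp [hva.symm])
        · exact absurd hy' (hvC₀ y)
      · rw [strain_update_of_ne hx hy, strain_congr (hq x hx) (hq y hy) rfl rfl]
        refine hn x y (hxy.resolve_left fun h => ?_)
        have : v ∈ s(x, y) := h ▸ Sym2.mem_mk_left v a
        rcases Sym2.mem_iff.1 this with h | h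
        · exact hx h.symm
        · exact hy h.symm
    have h0 := row_mem_span_iff.1 hspan _ hm
    refine hab0 ?_
    simp only [strain, hqv, hq b hvb.symm, Function.update_self,
      Function.update_of_ne hvb.symm] at h0
    unfold strain
    linear_combination 2 * h0
  have hIc : LinearIndepOn ℝ (row q) C := by
    rw [hCeq]
    refine hIb.insert fun hspan => ?_
    have hm : Motion q (insert s(v, b) (insert s(v, a) C₀))
        (Function.update 0 v ![p b 1 - p a 1, -(p b 0 - p a 0)]) := by
      refine motion_update_zero fun y hy hy' => ?_
      rcases hy' with hy' | hy' | hy'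
      · rw [Sym2.congr_right.1 hy', hqv, hqv, hq b hvb.symm]
        simp
        ring
      · rw [Sym2.congr_right.1 hy', hqv, hqv, hq a hva.symm]
        simp
        ring
      · exact absurd hy' (hvC₀ y)
    have h0 := row_mem_span_iff.1 hspan _ hm
    rw [strain_update_zero hvc.symm, hqv, hqv, hq c hvc.symm] at h0
    refine hp.area_ne a b c ⟨hab, hac, hbc⟩ ?_
    simp only [Matrix.cons_val_zero, Matrix.cons_val_one] at h0
    unfold area
    linear_combination h0
  exact hC.not_indep (hp.indep C q hIc)

theorem exists_rigid_subset (hd : ∀ e ∈ C, ¬ e.IsDiag)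
    (ih : ∀ D : Set (Sym2 V), (linMatroid (row p)).IsCircuit D → (∀ e ∈ D, ¬ e.IsDiag) →
      vertexSpan D ⊂ vertexSpan C → Rigid p D (vertexSpan D))
    {v a b : V} (hva : s(v, a) ∈ C) (hvb : s(v, b) ∈ C) (hab : a ≠ b)
    (hspan : ∀ n, Motion p {e | e ∈ C ∧ v ∉ e} n → strain p n a b = 0) :
    ∃ A ⊆ {e | e ∈ C ∧ v ∉ e}, ∃ X : Set V, a ∈ X ∧ b ∈ X ∧ vertexSpan A ⊆ X ∧ Rigid p A X := by
  have hav : a ≠ v := fun h => hd _ hva (by simp [h])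
  have hbv : b ≠ v := fun h => hd _ hvb (by simp [h])
  by_cases hmem : s(a, b) ∈ {e | e ∈ C ∧ v ∉ e}
  · refine ⟨{s(a, b)}, by simpa using hmem, {a, b}, by simp, by simp, ?_, ?_⟩
    · rintro x ⟨e, rfl, hx⟩
      simpa using hx
    · intro m hm x hx y hy
      have h := hm a b rfl
      rcases hx with rfl | rfl <;> rcases hy with rfl | rfl
      · simp
      · exact h
      · rwa [strain_comm]
      · simp
  · have hcl := mem_linMatroid_closure (row_mem_span_iff.2 hspan)
    obtain ⟨D, hD, hDc, habD⟩ := (linMatroid (row p)).exists_isCircuit_of_mem_closure hcl hmem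
    have hDd : ∀ e ∈ D, ¬ e.IsDiag := by
      intro e he
      rcases hD he with rfl | h
      · simpa using hab
      · exact hd e h.1
    have hvD : v ∉ vertexSpan D := by
      rintro ⟨e, he, hve⟩
      rcases hD he with rfl | h
      · rcases Sym2.mem_iff.1 hve with h | h
        · exact hav h.symm
        · exact hbv h.symm
      · exact h.2 hve
    have hss : vertexSpan D ⊂ vertexSpan C := by
      refine ⟨?_, fun h => hvD (h ⟨_, hva, Sym2.mem_mk_left v a⟩)⟩
      rintro x ⟨e, he, hx⟩
      rcases hD he with rfl | h
      · rcases Sym2.mem_iff.1 hx with rfl | rfl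
        · exact ⟨_, hva, Sym2.mem_mk_right v x⟩
        · exact ⟨_, hvb, Sym2.mem_mk_right v x⟩
      · exact ⟨e, h.1, hx⟩
    refine ⟨D \ {s(a, b)}, fun e he => (hD he.1).resolve_left he.2, vertexSpan D,
      ⟨_, habD, Sym2.mem_mk_left a b⟩, ⟨_, habD, Sym2.mem_mk_right a b⟩,
      fun x ⟨e, he, hx⟩ => ⟨e, he.1, hx⟩, fun m hm => ih D hDc hDd hss m fun x y hxy => ?_⟩
    by_cases hxy' : s(x, y) = s(a, b)
    · rw [← hxy'] at hm
      exact strain_eq_zero_of_isCircuit hDc hxy hm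
    · exact hm x y ⟨hxy, hxy'⟩

/-- Circuits of the generic planar rigidity matroid are rigid. -/
theorem rigid_of_isCircuit (hp : GenPos p) (hC : (linMatroid (row p)).IsCircuit C)
    (hd : ∀ e ∈ C, ¬ e.IsDiag) : Rigid p C (vertexSpan C) := by
  induction hk : (vertexSpan C).ncard using Nat.strong_induction_on generalizing C with
  | _ k ih =>
  subst hk
  have ih' (D : Set (Sym2 V)) (hD : (linMatroid (row p)).IsCircuit D)
      (hDd : ∀ e ∈ D, ¬ e.IsDiag) (hss : vertexSpan D ⊂ vertexSpan C) :
      Rigid p D (vertexSpan D) :=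
    ih _ (Set.ncard_lt_ncard hss (Set.toFinite _)) hD hDd rfl
  clear ih
  obtain ⟨v, ⟨e, heC, w, rfl⟩, hdeg⟩ := exists_degree_le_three hC hd
  have hne (w : V) (hw : s(v, w) ∈ C) : v ≠ w := by simpa using hd _ hw
  have hpos : 0 < {w | s(v, w) ∈ C}.ncard := (Set.ncard_pos (Set.toFinite _)).2 ⟨w, heC⟩
  obtain h | h | h : {w | s(v, w) ∈ C}.ncard = 1 ∨ {w | s(v, w) ∈ C}.ncard = 2 ∨
      {w | s(v, w) ∈ C}.ncard = 3 := by omega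
  · obtain ⟨a, h⟩ := Set.ncard_eq_one.1 h
    have hmem (w : V) : s(v, w) ∈ C ↔ w = a := Set.ext_iff.1 h w
    exact absurd h (isCircuit_star_ne_singleton hp hC (hne a ((hmem a).2 rfl)))
  · obtain ⟨a, b, hab, h⟩ := Set.ncard_eq_two.1 h
    have hmem (w : V) : s(v, w) ∈ C ↔ w = a ∨ w = b := Set.ext_iff.1 h w
    exact absurd h (isCircuit_star_ne_pair hp hC (hne a ((hmem a).2 (Or.inl rfl)))
      (hne b ((hmem b).2 (Or.inr rfl))) hab)
  obtain ⟨a, b, c, hab, hac, hbc, h⟩ := Set.ncard_eq_three.1 h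
  have hmem (w : V) : s(v, w) ∈ C ↔ w = a ∨ w = b ∨ w = c := Set.ext_iff.1 h w
  have ha := (hmem a).2 (by simp)
  have hb := (hmem b).2 (by simp)
  have hc := (hmem c).2 (by simp)
  have hva := hne a ha
  have hvb := hne b hb
  have hvc := hne c hc
  obtain ⟨A₁, hA₁, X₁, ha₁, hb₁, hX₁, hR₁⟩ := exists_rigid_subset hd ih' ha hb hab
    fun n => strain_eq_zero_of_degree_three hp hC hva hvb hvc hab hac hbc h
  obtain ⟨A₂, hA₂, X₂, hb₂, hc₂, hX₂, hR₂⟩ := exists_rigid_subset hd ih' hb hc hbc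
    fun n => strain_eq_zero_of_degree_three hp hC hvb hvc hva hbc hab.symm hac.symm
      (by rw [h]; ext; simp; tauto)
  obtain ⟨A₃, hA₃, X₃, ha₃, hc₃, hX₃, hR₃⟩ := exists_rigid_subset hd ih' ha hc hac
    fun n => strain_eq_zero_of_degree_three hp hC hva hvc hvb hac hab hbc.symm
      (by rw [h]; ext; simp; tauto)
  let B : Set (Sym2 V) := A₁ ∪ A₂ ∪ A₃ ∪ {s(v, a), s(v, b)}
  have hB₁ : A₁ ⊆ B := fun e he => Or.inl (Or.inl (Or.inl he))
  have hB₂ : A₂ ⊆ B := fun e he => Or.inl (Or.inl (Or.inr he))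
  have hB₃ : A₃ ⊆ B := fun e he => Or.inl (Or.inr he)
  have hBa : s(v, a) ∈ B := Or.inr (Or.inl rfl)
  have hBb : s(v, b) ∈ B := Or.inr (Or.inr rfl)
  have hnorm (m : V → Fin 2 → ℝ) (hm : Motion p B m) : ∃ n,
      (∀ x y, strain p n x y = strain p m x y) ∧ Motion p B n ∧
        n a = 0 ∧ n b = 0 ∧ n c = 0 ∧ n v = 0 := by
    obtain ⟨n, hn, hna, hnb⟩ := exists_normalized (hp.ne a b hab)
      (hR₁ m (hm.mono hB₁) a ha₁ b hb₁)
    have hnB : Motion p B n := fun x y hxy => (hn x y).trans (hm x y hxy)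
    refine ⟨n, hn, hnB, hna, hnb, ?_, ?_⟩
    · exact hp.eq_zero_of_strain hab hna hnb (hR₃ n (hnB.mono hB₃) c hc₃ a ha₃)
        (hR₂ n (hnB.mono hB₂) c hc₂ b hb₂)
    · exact hp.eq_zero_of_strain hab hna hnb (hnB _ _ hBa) (hnB _ _ hBb)
  have hspan : row p s(v, c) ∈ Submodule.span ℝ (row p '' B) := by
    refine row_mem_span_iff.2 fun m hm => ?_
    obtain ⟨n, hn, -, -, -, hnc, hnv⟩ := hnorm m hm
    rw [← hn]
    exact strain_eq_zero_of_eq (hnv.trans hnc.symm)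
  have hcB : s(v, c) ∉ B := by
    have hv : v ∈ s(v, c) := Sym2.mem_mk_left v c
    rintro (((h | h) | h) | h | h)
    · exact (hA₁ h).2 hv
    · exact (hA₂ h).2 hv
    · exact (hA₃ h).2 hv
    · exact hac (Sym2.congr_right.1 h).symm
    · exact hbc (Sym2.congr_right.1 h).symm
  have hBC : insert s(v, c) B = C := by
    have hsub : insert s(v, c) B ⊆ C := by
      refine Set.insert_subset hc ?_
      rintro e (((h | h) | h) | rfl | rfl)
      · exact (hA₁ h).1
      · exact (hA₂ h).1
      · exact (hA₃ h).1
      · exact ha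
      · exact hb
    by_contra hne
    have hI : LinearIndepOn ℝ (row p) (insert s(v, c) B) :=
      hC.ssubset_indep (hsub.ssubset_of_ne hne)
    exact ((linearIndepOn_insert hcB).1 hI).2 hspan
  intro m hm x hx y hy
  obtain ⟨n, hn, hnB, hna, hnb, hnc, hnv⟩ :=
    hnorm m (hm.mono (hBC ▸ Set.subset_insert _ _))
  have hzero : ∀ x ∈ vertexSpan C, n x = 0 := by
    rintro x ⟨e, he, hx⟩
    rw [← hBC] at he
    rcases he with rfl | ((h | h) | h) | rfl | rfl
    · rcases Sym2.mem_iff.1 hx with rfl | rfl <;> assumption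
    · exact hR₁.eq_zero hp (hnB.mono hB₁) hab ha₁ hb₁ (hX₁ ⟨e, h, hx⟩) hna hnb
    · exact hR₂.eq_zero hp (hnB.mono hB₂) hbc hb₂ hc₂ (hX₂ ⟨e, h, hx⟩) hnb hnc
    · exact hR₃.eq_zero hp (hnB.mono hB₃) hac ha₃ hc₃ (hX₃ ⟨e, h, hx⟩) hna hnc
    · rcases Sym2.mem_iff.1 hx with rfl | rfl <;> assumption
    · rcases Sym2.mem_iff.1 hx with rfl | rfl <;> assumption
  rw [← hn]
  exact strain_eq_zero_of_eq ((hzero x hx).trans (hzero y hy).symm)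

/-- Components are rigid. -/
theorem rigid_circuitClass (hp : GenPos p) {E : Set (Sym2 V)} (hE : ∀ e ∈ E, ¬ e.IsDiag)
    {e : Sym2 V} (he : e ∈ E) :
    Rigid p (circuitClass (linMatroid (row p)) E e)
      (vertexSpan (circuitClass (linMatroid (row p)) E e)) := by
  induction e with
  | _ a b =>
  have hab : a ≠ b := by simpa using hE _ he
  intro m hm x hx y hy
  obtain ⟨n, hn, hna, hnb⟩ := exists_normalized (hp.ne a b hab) (hm a b ⟨he, Or.inl rfl⟩)
  have hzero : ∀ x ∈ vertexSpan (circuitClass (linMatroid (row p)) E s(a, b)), n x = 0 := by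
    rintro x ⟨g, ⟨hgE, rfl | ⟨C, hCE, hC, heC, hgC⟩⟩, hx⟩
    · rcases Sym2.mem_iff.1 hx with rfl | rfl <;> assumption
    · refine (rigid_of_isCircuit hp hC fun e he => hE e (hCE he)).eq_zero hp (m := n) ?_ hab
        ⟨_, heC, Sym2.mem_mk_left a b⟩ ⟨_, heC, Sym2.mem_mk_right a b⟩ ⟨g, hgC, hx⟩ hna hnb
      intro x y hxy
      rw [hn]
      exact hm x y ⟨hCE hxy, Or.inr ⟨C, hCE, hC, heC, hxy⟩⟩
  rw [← hn]
  exact strain_eq_zero_of_eq ((hzero x hx).trans (hzero y hy).symm)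

end Rigidity

theorem edgeSet_addEdge (G : SimpleGraph V) {u v : V} (huv : u ≠ v) :
    (addEdge G u v).edgeSet = insert s(u, v) G.edgeSet := by
  ext e
  induction e with
  | _ x y =>
    simp [addEdge]
    grind

theorem vertexSpan_insert {F : Set (Sym2 V)} {u v : V} (hu : u ∈ vertexSpan F)
    (hv : v ∈ vertexSpan F) : vertexSpan (insert s(u, v) F) = vertexSpan F := by
  ext x
  constructor
  · rintro ⟨e, rfl | he, hx⟩
    · rcases Sym2.mem_iff.1 hx with rfl | rfl <;> assumption
    · exact ⟨e, he, hx⟩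
  · rintro ⟨e, he, hx⟩
    exact ⟨e, Or.inr he, hx⟩

/-- If `u,v` is a non-adjacent pair inside the `ℛ₂`-component `F₁` of `G`, then the
`ℛ₂`-components of `G+uv` are `F₁+uv` together with the other `ℛ₂`-components of
`G`; in particular the vertex sets of the `ℛ₂`-components are unchanged. -/
theorem rdComponents_addEdge {V : Type*} [Fintype V] [DecidableEq V]
    (G : SimpleGraph V) (u v : V) (huv : u ≠ v) (hadj : ¬ G.Adj u v)
    (F₁ : Set (Sym2 V)) (hF₁ : IsRdComponent 2 G F₁)
    (hu : u ∈ vertexSpan F₁) (hv : v ∈ vertexSpan F₁) :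
    {F : Set (Sym2 V) | IsRdComponent 2 (addEdge G u v) F} =
      insert (insert s(u, v) F₁) ({F | IsRdComponent 2 G F} \ {F₁}) ∧
    {X : Set V | ∃ F, IsRdComponent 2 (addEdge G u v) F ∧ X = vertexSpan F} =
      {X : Set V | ∃ F, IsRdComponent 2 G F ∧ X = vertexSpan F} := by
  have hE : {F : Set (Sym2 V) | IsRdComponent 2 (addEdge G u v) F} =
      insert (insert s(u, v) F₁) ({F | IsRdComponent 2 G F} \ {F₁}) := by
    obtain ⟨p, hp⟩ := exists_genPos (V := V)
    obtain ⟨e, he, rfl⟩ := hp.isRdComponent_iff.1 hF₁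
    have hclosure := mem_linMatroid_closure (row_mem_span_iff.2 fun m hm =>
      rigid_circuitClass hp (fun e => G.not_isDiag_of_mem_edgeSet) he m hm u hu v hv)
    have hloop : ¬ (linMatroid (row p)).IsCircuit {s(u, v)} := by
      intro h
      have h0 := h.not_indep
      rw [linMatroid_indep, linearIndepOn_singleton_iff, not_not] at h0
      have h1 := congrFun h0 (u, 0)
      simp [edgeVec, sub_eq_zero, hp.ne u v huv] at h1
    simp only [hp.isRdComponent_iff, edgeSet_addEdge G huv]
    exact setOf_circuitClass_insert hadj hclosure hloop
  refine ⟨hE, ?_⟩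
  have hE' (F : Set (Sym2 V)) : IsRdComponent 2 (addEdge G u v) F ↔
      F = insert s(u, v) F₁ ∨ IsRdComponent 2 G F ∧ F ≠ F₁ := Set.ext_iff.1 hE F
  have hspan := vertexSpan_insert hu hv
  ext X
  constructor
  · rintro ⟨F, hF, rfl⟩
    rcases (hE' F).1 hF with rfl | ⟨hF, -⟩
    · exact ⟨F₁, hF₁, hspan⟩
    · exact ⟨F, hF, rfl⟩
  · rintro ⟨F, hF, rfl⟩
    by_cases h : F = F₁
    · exact ⟨_, (hE' _).2 (Or.inl rfl), by rw [h, hspan]⟩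
    · exact ⟨F, (hE' F).2 (Or.inr ⟨hF, h⟩), rfl⟩

end Rigidity
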